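/- arXiv:2308.13277 — 2 statements merged into one kernel-verified Lean document; each statement's English description precedes it below -/
import Mathlib

section
/- Let n ≥ 2 and let H_{W,0} := Σ_{i=1}^{n−1} P_{i,i+1} act on (ℂ²)^{⊗n}. Then H_{W,0} is positive semidefinite, and its kernel (equivalently, its ground space, of eigenvalue 0) is exactly the two-dimensional subspace spanned by the all-zeros state |0⟩^{⊗n} and the generalized W state |W_n⟩; in particular H_{W,0} is frustration free with these two states as its only ground states. -/
open Matrix
open scoped Kronecker ComplexOrder

namespace QSim

/-- Index set for the computational basis of `n` qubits. -/
abbrev QIdx (n : ℕ) := Fin n → Fin 2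

/-- Operators (matrices) on the Hilbert space of `n` qubits. -/
abbrev QOp (n : ℕ) := Matrix (QIdx n) (QIdx n) ℂ

/-- The operator (`ℓ²→ℓ²`) norm of a (possibly rectangular) matrix. -/
noncomputable def opNorm {I J : Type*} [Fintype I] [Fintype J] [DecidableEq J]
    (M : Matrix I J ℂ) : ℝ :=
  ‖LinearMap.toContinuousLinearMap (Matrix.toEuclideanLin M)‖

/-- A two-qubit operator `E` placed on qubits `i` and `j` of an `n`-qubit register
(identity elsewhere), given entrywise. -/
def twoQubitOp (n : ℕ) (i j : Fin n) (E : Fin 2 → Fin 2 → Fin 2 → Fin 2 → ℂ) : QOp n :=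
  fun x y => E (x i) (x j) (y i) (y j) * (if ∀ k, k ≠ i → k ≠ j → x k = y k then 1 else 0)

/-- A single-qubit operator `E` placed on qubit `i` of an `n`-qubit register. -/
def oneQubitOp (n : ℕ) (i : Fin n) (E : Matrix (Fin 2) (Fin 2) ℂ) : QOp n :=
  fun x y => E (x i) (y i) * (if ∀ k, k ≠ i → x k = y k then 1 else 0)

/-- Sign used to build `(|01⟩ - |10⟩)/√2`. -/
def sgnE (a b : Fin 2) : ℂ :=
  if a = 0 ∧ b = 1 then 1 else if a = 1 ∧ b = 0 then -1 else 0

/-- Entries of the two-qubit projector `P` onto `span{(|01⟩-|10⟩)/√2, |11⟩}`: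
`P = (1/2)(|01⟩-|10⟩)(⟨01|-⟨10|) + |11⟩⟨11|`. -/
noncomputable def Pentry (a b c d : Fin 2) : ℂ :=
  (1 / 2) * sgnE a b * sgnE c d + (if a = 1 ∧ b = 1 ∧ c = 1 ∧ d = 1 then 1 else 0)

/-- `H_{W,0} = Σ_{i=1}^{n-1} P_{i,i+1}`. -/
noncomputable def HW0 (n : ℕ) : QOp n :=
  ∑ i : Fin (n - 1),
    twoQubitOp n ⟨i.1, by have := i.2; omega⟩ ⟨i.1 + 1, by have := i.2; omega⟩ Pentry

/-- The all-zeros state `|0…0⟩`. -/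
def ket0 (n : ℕ) : QIdx n → ℂ := fun x => if ∀ k, x k = 0 then 1 else 0

/-- The generalized W state `|W_n⟩ = n^{-1/2} Σ_i |e_i⟩`. -/
noncomputable def Wstate (n : ℕ) : QIdx n → ℂ := fun x =>
  if (Finset.univ.filter fun k => x k = 1).card = 1 then (((Real.sqrt n)⁻¹ : ℝ) : ℂ) else 0

end QSim

namespace QSim

/-- The projector `P` on qubits `i` and `j` is `(1 - SWAP) / 2 + |11⟩⟨11|`, entrywise. -/
lemma twoQubitOp_Pentry_apply {n : ℕ} (i j : Fin n) (x y : QIdx n) :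
    twoQubitOp n i j Pentry x y =
      (1 / 2) * ((if x = y then 1 else 0) - if x ∘ Equiv.swap i j = y then 1 else 0) +
        if x i = 1 ∧ x j = 1 then (if x = y then 1 else 0) else 0 := by
  unfold twoQubitOp
  by_cases h : ∀ k, k ≠ i → k ≠ j → x k = y k
  · have h1 : x = y ↔ x i = y i ∧ x j = y j := by
      refine ⟨fun h => by simp [h], fun ⟨hi, hj⟩ => funext fun k => ?_⟩
      by_cases hki : k = i
      · rwa [hki]
      by_cases hkj : k = j
      · rwa [hkj]
      exact h k hki hkj
    have h2 : x ∘ Equiv.swap i j = y ↔ x j = y i ∧ x i = y j := by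
      refine ⟨fun h => by simp [← h], fun ⟨hi, hj⟩ => funext fun k => ?_⟩
      by_cases hki : k = i
      · simpa [hki]
      by_cases hkj : k = j
      · simpa [hkj]
      simpa [Equiv.swap_apply_of_ne_of_ne hki hkj] using h k hki hkj
    rw [if_pos h]
    simp only [h1, h2]
    generalize x i = a
    generalize x j = b
    generalize y i = c
    generalize y j = d
    fin_cases a <;> fin_cases b <;> fin_cases c <;> fin_cases d <;>
      norm_num [Pentry, sgnE]
  · have h1 : x ≠ y := fun hxy => h fun k _ _ => by rw [hxy]
    have h2 : x ∘ Equiv.swap i j ≠ y := fun hxy => h fun k hki hkj => by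
      simp [← hxy, Equiv.swap_apply_of_ne_of_ne hki hkj]
    simp [h, h1, h2]

lemma twoQubitOp_Pentry_mulVec {n : ℕ} (i j : Fin n) (v : QIdx n → ℂ) (x : QIdx n) :
    (twoQubitOp n i j Pentry *ᵥ v) x =
      (1 / 2) * (v x - v (x ∘ Equiv.swap i j)) + if x i = 1 ∧ x j = 1 then v x else 0 := by
  simp only [mulVec, dotProduct, twoQubitOp_Pentry_apply, add_mul, Finset.sum_add_distrib,
    mul_assoc, sub_mul, ← Finset.mul_sum, Finset.sum_sub_distrib]
  split_ifs <;> simp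

lemma comp_swap_eq_self {n : ℕ} {i j : Fin n} {x : QIdx n} (h : x i = x j) :
    x ∘ Equiv.swap i j = x := by
  funext k
  simp only [Function.comp_apply, Equiv.swap_apply_def]
  split_ifs <;> simp_all

lemma comp_swap_comp_swap {n : ℕ} (i j : Fin n) (x : QIdx n) :
    (x ∘ Equiv.swap i j) ∘ Equiv.swap i j = x := by
  funext k
  simp

lemma isHermitian_twoQubitOp_Pentry {n : ℕ} (i j : Fin n) :
    (twoQubitOp n i j Pentry).IsHermitian := by
  ext x y
  have h : ∀ a b c d, star (Pentry c d a b) = Pentry a b c d := by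
    intro a b c d
    fin_cases a <;> fin_cases b <;> fin_cases c <;> fin_cases d <;> simp [Pentry, sgnE]
  have h2 : (∀ k, k ≠ i → k ≠ j → y k = x k) ↔ ∀ k, k ≠ i → k ≠ j → x k = y k :=
    forall_congr' fun k => by rw [eq_comm]
  simp only [conjTranspose_apply, twoQubitOp, star_mul', h, h2]
  split_ifs <;> simp

lemma twoQubitOp_Pentry_mul_self {n : ℕ} (i j : Fin n) :
    twoQubitOp n i j Pentry * twoQubitOp n i j Pentry = twoQubitOp n i j Pentry := by
  apply Matrix.mulVec_injective
  funext v x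
  rw [← mulVec_mulVec]
  simp only [twoQubitOp_Pentry_mulVec, comp_swap_comp_swap]
  by_cases h : x i = 1 ∧ x j = 1
  · simp [h, comp_swap_eq_self (h.1.trans h.2.symm)]
  · have h' : ¬ (x j = 1 ∧ x i = 1) := fun hh => h hh.symm
    simp only [Function.comp_apply, Equiv.swap_apply_left, Equiv.swap_apply_right, h, h', if_false]
    ring

lemma posSemidef_twoQubitOp_Pentry {n : ℕ} (i j : Fin n) :
    (twoQubitOp n i j Pentry).PosSemidef := by
  have h := posSemidef_conjTranspose_mul_self (twoQubitOp n i j Pentry)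
  rwa [(isHermitian_twoQubitOp_Pentry i j).eq, twoQubitOp_Pentry_mul_self] at h

/-- A state is annihilated by `P` on qubits `i` and `j` iff it is symmetric under exchanging
them and has no component with both of them excited. -/
lemma twoQubitOp_Pentry_mulVec_eq_zero_iff {n : ℕ} (i j : Fin n) (v : QIdx n → ℂ) :
    twoQubitOp n i j Pentry *ᵥ v = 0 ↔
      (∀ x, v (x ∘ Equiv.swap i j) = v x) ∧ ∀ x, x i = 1 → x j = 1 → v x = 0 := by
  constructor
  · intro h
    have key : ∀ x, x i = 1 → x j = 1 → v x = 0 := fun x hi hj => by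
      have := congrFun h x
      rw [twoQubitOp_Pentry_mulVec, comp_swap_eq_self (hi.trans hj.symm)] at this
      simpa [hi, hj] using this
    refine ⟨fun x => ?_, key⟩
    by_cases hx : x i = 1 ∧ x j = 1
    · rw [comp_swap_eq_self (hx.1.trans hx.2.symm)]
    · have := congrFun h x
      rw [twoQubitOp_Pentry_mulVec, if_neg hx] at this
      simp only [Pi.zero_apply] at this
      linear_combination (-2) * this
  · rintro ⟨h1, h2⟩
    funext x
    rw [twoQubitOp_Pentry_mulVec, h1]
    split_ifs with hx
    · simp [h2 x hx.1 hx.2]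
    · simp

/-- Frustration-freeness: a sum of positive semidefinite matrices annihilates exactly the vectors
annihilated by every summand. -/
lemma sum_mulVec_eq_zero_iff {ι I : Type*} [Fintype ι] [Fintype I] {A : ι → Matrix I I ℂ}
    (hA : ∀ i, (A i).PosSemidef) (v : I → ℂ) :
    (∑ i, A i) *ᵥ v = 0 ↔ ∀ i, A i *ᵥ v = 0 := by
  rw [sum_mulVec]
  refine ⟨fun h i => ?_, fun h => Finset.sum_eq_zero fun i _ => h i⟩
  have h0 : ∑ i, star v ⬝ᵥ (A i *ᵥ v) = 0 := by
    rw [← dotProduct_sum, h, dotProduct_zero]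
  rw [Finset.sum_eq_zero_iff_of_nonneg fun i _ => (hA i).dotProduct_mulVec_nonneg v] at h0
  exact ((hA i).dotProduct_mulVec_zero_iff v).1 (h0 i (Finset.mem_univ i))

lemma HW0_succ (m : ℕ) :
    HW0 (m + 1) = ∑ i : Fin m, twoQubitOp (m + 1) i.castSucc i.succ Pentry := rfl

lemma HW0_mulVec_eq_zero_iff {m : ℕ} (v : QIdx (m + 1) → ℂ) :
    HW0 (m + 1) *ᵥ v = 0 ↔
      ∀ i : Fin m, (∀ x, v (x ∘ Equiv.swap i.castSucc i.succ) = v x) ∧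
        ∀ x, x i.castSucc = 1 → x i.succ = 1 → v x = 0 := by
  have hpos (i : Fin m) : (twoQubitOp (m + 1) i.castSucc i.succ Pentry).PosSemidef :=
    posSemidef_twoQubitOp_Pentry i.castSucc i.succ
  rw [HW0_succ, sum_mulVec_eq_zero_iff hpos]
  exact forall_congr' fun i => twoQubitOp_Pentry_mulVec_eq_zero_iff i.castSucc i.succ v

/-- Invariance under adjacent transpositions implies invariance under all permutations. -/
lemma apply_comp_perm_of_adjacent {m : ℕ} {v : QIdx (m + 1) → ℂ}
    (h : ∀ (i : Fin m) x, v (x ∘ Equiv.swap i.castSucc i.succ) = v x)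
    (σ : Equiv.Perm (Fin (m + 1))) (x : QIdx (m + 1)) : v (x ∘ σ) = v x := by
  have hσ : σ ∈ Submonoid.closure
      (Set.range fun i : Fin m => Equiv.swap i.castSucc i.succ) := by
    rw [Equiv.Perm.mclosure_swap_castSucc_succ]
    trivial
  induction hσ using Submonoid.closure_induction generalizing x with
  | mem σ hσ =>
    obtain ⟨i, rfl⟩ := hσ
    exact h i x
  | one => rfl
  | mul σ τ _ _ hσ hτ =>
    rw [Equiv.Perm.coe_mul, ← Function.comp_assoc, hτ, hσ]

lemma exists_perm_zero_one {m : ℕ} {a b : Fin (m + 2)} (hab : a ≠ b) :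
    ∃ σ : Equiv.Perm (Fin (m + 2)), σ 0 = a ∧ σ 1 = b := by
  have hc : (0 : Fin (m + 2)) ≠ Equiv.swap 0 a b := by
    intro h
    apply hab
    simpa using congrArg (Equiv.swap 0 a) h
  refine ⟨Equiv.swap 0 a * Equiv.swap 1 (Equiv.swap 0 a b), ?_, ?_⟩
  · rw [Equiv.Perm.mul_apply, Equiv.swap_apply_of_ne_of_ne zero_ne_one hc, Equiv.swap_apply_left]
  · simp

lemma ket0_comp_perm {n : ℕ} (σ : Equiv.Perm (Fin n)) (x : QIdx n) :
    ket0 n (x ∘ σ) = ket0 n x := by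
  have : (∀ k, x (σ k) = 0) ↔ ∀ k, x k = 0 :=
    σ.forall_congr_left.trans (by simp)
  simp [ket0, this]

lemma ket0_eq_zero {n : ℕ} {x : QIdx n} {a : Fin n} (ha : x a = 1) : ket0 n x = 0 := by
  unfold ket0
  rw [if_neg]
  intro h
  simp [h a] at ha

lemma ket0_single {n : ℕ} (a : Fin n) : ket0 n (Pi.single a 1) = 0 :=
  ket0_eq_zero (a := a) (by simp)

lemma Wstate_comp_perm {n : ℕ} (σ : Equiv.Perm (Fin n)) (x : QIdx n) :
    Wstate n (x ∘ σ) = Wstate n x := by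
  have : (Finset.univ.filter fun k => (x ∘ σ) k = 1).card =
      (Finset.univ.filter fun k => x k = 1).card :=
    Finset.card_equiv σ fun k => by simp
  simp only [Wstate, this]

lemma Wstate_eq_zero {n : ℕ} {x : QIdx n} {a b : Fin n} (hab : a ≠ b) (ha : x a = 1)
    (hb : x b = 1) : Wstate n x = 0 := by
  unfold Wstate
  rw [if_neg]
  intro h
  exact hab (Finset.card_le_one.1 h.le a (by simpa using ha) b (by simpa using hb))

lemma Wstate_zero (n : ℕ) : Wstate n 0 = 0 := by
  simp [Wstate]

lemma ket0_zero (n : ℕ) : ket0 n 0 = 1 := by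
  simp [ket0]

lemma Wstate_single {n : ℕ} (a : Fin n) :
    Wstate n (Pi.single a 1) = (((Real.sqrt n)⁻¹ : ℝ) : ℂ) := by
  have : (Finset.univ.filter fun k => (Pi.single a 1 : QIdx n) k = 1) = {a} := by
    ext k
    simp [Pi.single_apply]
  simp [Wstate, this]

lemma eq_zero_or_single_or_two {n : ℕ} (x : QIdx n) :
    x = 0 ∨ (∃ a, x = Pi.single a 1) ∨ ∃ a b, a ≠ b ∧ x a = 1 ∧ x b = 1 := by
  have h01 : ∀ c : Fin 2, c ≠ 1 → c = 0 := by decide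
  by_cases h : ∃ a, x a = 1
  · obtain ⟨a, ha⟩ := h
    by_cases h' : ∃ b, a ≠ b ∧ x b = 1
    · obtain ⟨b, hab, hb⟩ := h'
      exact .inr (.inr ⟨a, b, hab, ha, hb⟩)
    · push Not at h'
      refine .inr (.inl ⟨a, funext fun k => ?_⟩)
      by_cases hk : a = k
      · subst hk
        simpa using ha
      · rw [Pi.single_eq_of_ne' hk]
        exact h01 _ (h' k hk)
  · push Not at h
    exact .inl (funext fun k => h01 _ (h k))

lemma sqrt_inv_ne_zero (m : ℕ) : (((Real.sqrt (m + 2 : ℕ))⁻¹ : ℝ) : ℂ) ≠ 0 := by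
  rw [Complex.ofReal_ne_zero]
  positivity

lemma linearIndependent_ket0_Wstate (m : ℕ) :
    LinearIndependent ℂ ![ket0 (m + 2), Wstate (m + 2)] := by
  rw [LinearIndependent.pair_iff]
  intro s t h
  have h0 := congrFun h 0
  have h1 := congrFun h (Pi.single 0 1)
  simp only [Pi.add_apply, Pi.smul_apply, smul_eq_mul, Pi.zero_apply, ket0_zero, Wstate_zero,
    Wstate_single, ket0_single, mul_one, mul_zero, add_zero, zero_add] at h0 h1
  exact ⟨h0, (mul_eq_zero.1 h1).resolve_right (sqrt_inv_ne_zero m)⟩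

lemma ker_HW0 (m : ℕ) :
    LinearMap.ker (HW0 (m + 2)).mulVecLin =
      Submodule.span ℂ ({ket0 (m + 2), Wstate (m + 2)} : Set (QIdx (m + 2) → ℂ)) := by
  apply le_antisymm
  · intro v hv
    rw [LinearMap.mem_ker, mulVecLin_apply, HW0_mulVec_eq_zero_iff] at hv
    have hperm := apply_comp_perm_of_adjacent fun i => (hv i).1
    rw [Submodule.mem_span_pair]
    refine ⟨v 0, v (Pi.single 0 1) * ((((Real.sqrt (m + 2 : ℕ))⁻¹ : ℝ) : ℂ))⁻¹,
      funext fun x => ?_⟩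
    simp only [Pi.add_apply, Pi.smul_apply, smul_eq_mul]
    rcases eq_zero_or_single_or_two x with rfl | ⟨a, rfl⟩ | ⟨a, b, hab, ha, hb⟩
    · simp [ket0_zero, Wstate_zero]
    · have hs : (Pi.single a 1 : QIdx (m + 2)) ∘ Equiv.swap 0 a = Pi.single 0 1 := by
        funext k
        simp [Pi.single_apply, Equiv.swap_apply_eq_iff]
      rw [ket0_single, Wstate_single,
        inv_mul_cancel_right₀ (sqrt_inv_ne_zero m), ← hs, hperm]
      simp
    · obtain ⟨σ, h0, h1⟩ := exists_perm_zero_one hab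
      rw [ket0_eq_zero ha, Wstate_eq_zero hab ha hb, ← hperm σ x,
        (hv 0).2 (x ∘ σ) (by simpa [h0] using ha) (by simpa [h1] using hb)]
      simp
  · rw [Submodule.span_le, Set.insert_subset_iff, Set.singleton_subset_iff]
    simp only [SetLike.mem_coe, LinearMap.mem_ker, mulVecLin_apply, HW0_mulVec_eq_zero_iff]
    exact ⟨fun i => ⟨ket0_comp_perm _, fun x hx _ => ket0_eq_zero hx⟩,
      fun i => ⟨Wstate_comp_perm _, fun x => Wstate_eq_zero (Fin.castSucc_lt_succ (i := i)).ne⟩⟩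

/-- For `n ≥ 2`, `H_{W,0} = Σ_{i=1}^{n-1} P_{i,i+1}` is positive semidefinite,
and its kernel (its frustration-free ground space, of eigenvalue 0) is exactly the
two-dimensional subspace spanned by `|0⟩^{⊗n}` and the generalized W state `|W_n⟩`. -/
theorem HW0_posSemidef_and_kernel (n : ℕ) (hn : 2 ≤ n) :
    (HW0 n).PosSemidef ∧
    LinearMap.ker (HW0 n).mulVecLin
      = Submodule.span ℂ ({ket0 n, Wstate n} : Set (QIdx n → ℂ)) ∧
    Module.finrank ℂ (Submodule.span ℂ ({ket0 n, Wstate n} : Set (QIdx n → ℂ))) = 2 := by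
  obtain ⟨m, rfl⟩ := Nat.exists_eq_add_of_le' hn
  refine ⟨?_, ker_HW0 m, ?_⟩
  · rw [HW0_succ]
    exact posSemidef_sum _ fun i _ => posSemidef_twoQubitOp_Pentry i.castSucc i.succ
  · rw [← Matrix.range_cons_cons_empty _ _ ![],
      finrank_span_eq_card (linearIndependent_ket0_Wstate m), Fintype.card_fin]

end QSim
end

section
/- Let m ≥ 2 and γ ∈ (0,1) be such that l := γm and a := (1+γ)m/2 are positive integers. Let Λ = {1,…,m}, A = {1,…,a}, B = {m−a+1,…,m}, so |A| = |B| = a, |A∩B| = l, and A∪B = Λ. For a nonempty subset C ⊆ Λ define Π_C := (|0…0⟩⟨0…0|_C + |W⟩⟨W|_C) ⊗ I_{Λ∖C}, where |0…0⟩_C is the all-zeros state on the qubits of C and |W⟩_C is the generalized W state on the qubits of C. Then the operator norm satisfies ‖Π_{A∪B} − Π_A·Π_B‖ ≤ 5(1−γ)/(1+γ). -/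
open Matrix
open scoped Kronecker ComplexOrder

namespace QSim

/-- The orthogonal projector `Π_C = (|0…0⟩⟨0…0|_C + |W⟩⟨W|_C) ⊗ I_{Λ∖C}` onto the ground space
of `H_{W,0}` restricted to the qubits in `C`, written entrywise.  Here `|W⟩_C` is the
generalized W state on the qubits of `C` (with `⟨x|W⟩⟨W|y⟩ = 1/|C|` whenever `x` and `y` each
carry exactly one `1` inside `C`). -/
noncomputable def PiC (m : ℕ) (C : Finset (Fin m)) : QOp m := fun x y =>
  (if ∀ k ∉ C, x k = y k then 1 else 0) *
    ((if (∀ k ∈ C, x k = 0) ∧ (∀ k ∈ C, y k = 0) then 1 else 0) +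
      (if (C.filter fun k => x k = 1).card = 1 ∧ (C.filter fun k => y k = 1).card = 1
        then ((C.card : ℂ))⁻¹ else 0))

end QSim

namespace QSim

/-- The number of ones that `x` carries on the qubits of `C`. -/
def onesIn {m : ℕ} (C : Finset (Fin m)) (x : QIdx m) : ℕ := (C.filter fun k => x k = 1).card

/-- The bitstring that has a single one on `C`, at position `i`, and agrees with `x` off `C`. -/
def resetTo {m : ℕ} (C : Finset (Fin m)) (i : Fin m) (x : QIdx m) : QIdx m :=
  fun k => if k ∈ C then (if k = i then 1 else 0) else x k

/-- The bitstring with ones exactly at `i` and `j`. -/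
def pairIdx {m : ℕ} (i j : Fin m) : QIdx m := fun k => if k = i ∨ k = j then 1 else 0

theorem onesIn_eq_zero {m : ℕ} {C : Finset (Fin m)} {x : QIdx m} :
    onesIn C x = 0 ↔ ∀ k ∈ C, x k = 0 := by
  simp only [onesIn, Finset.card_eq_zero, Finset.filter_eq_empty_iff]
  exact forall₂_congr fun k _ => by omega

theorem onesIn_eq_one {m : ℕ} {C : Finset (Fin m)} {x : QIdx m} :
    onesIn C x = 1 ↔ ∃ i ∈ C, ∀ k ∈ C, x k = if k = i then 1 else 0 := by
  rw [onesIn, Finset.card_eq_one]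
  constructor
  · rintro ⟨i, hi⟩
    have h : ∀ k, (k ∈ C ∧ x k = 1) ↔ k = i := fun k => by
      simpa using Finset.ext_iff.mp hi k
    refine ⟨i, ((h i).2 rfl).1, fun k hk => ?_⟩
    split_ifs with hki
    · exact ((h k).2 hki).2
    · have : x k ≠ 1 := fun h1 => hki ((h k).1 ⟨hk, h1⟩)
      omega
  · rintro ⟨i, hi, h⟩
    refine ⟨i, Finset.ext fun k => ?_⟩
    simp only [Finset.mem_filter, Finset.mem_singleton]
    constructor
    · rintro ⟨hk, h1⟩
      by_contra hne
      simp [h k hk, hne] at h1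
    · rintro rfl
      exact ⟨hi, by simp [h k hi]⟩

theorem onesIn_union_compl {m : ℕ} (C : Finset (Fin m)) (x : QIdx m) :
    onesIn Finset.univ x = onesIn C x + onesIn Cᶜ x := by
  unfold onesIn
  rw [← Finset.card_union_of_disjoint, ← Finset.filter_union, Finset.union_compl]
  exact Finset.disjoint_filter_filter disjoint_compl_right

theorem onesIn_resetTo_self {m : ℕ} {C : Finset (Fin m)} {i : Fin m} (hi : i ∈ C) (x : QIdx m) :
    onesIn C (resetTo C i x) = 1 :=
  onesIn_eq_one.2 ⟨i, hi, fun k hk => by simp [resetTo, hk]⟩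

/-- The action of `Π_C` on a vector. -/
theorem PiC_mulVec {m : ℕ} (C : Finset (Fin m)) (f : QIdx m → ℂ) (x : QIdx m) :
    (PiC m C *ᵥ f) x = if onesIn C x = 0 then f x else
      if onesIn C x = 1 then (C.card : ℂ)⁻¹ * ∑ i ∈ C, f (resetTo C i x) else 0 := by
  have hinj : Set.InjOn (fun i => resetTo C i x) C := fun i hi j hj h => by
    have := congrFun h i
    by_contra hij
    simp_all [resetTo]
  have hentry : ∀ y, PiC m C x y = (if ∀ k ∉ C, x k = y k then 1 else 0) *
    ((if onesIn C x = 0 ∧ onesIn C y = 0 then 1 else 0) +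
      (if onesIn C x = 1 ∧ onesIn C y = 1 then (C.card : ℂ)⁻¹ else 0)) := fun y => by
    simp only [onesIn_eq_zero]
    rfl
  simp only [mulVec, dotProduct, hentry]
  by_cases h0 : onesIn C x = 0
  · rw [if_pos h0, Finset.sum_eq_single x]
    · simp [h0]
    · intro y _ hyx
      by_cases h1 : ∀ k ∉ C, x k = y k
      · have : onesIn C y ≠ 0 := fun hy => hyx <| funext fun k => by
          by_cases hk : k ∈ C
          · rw [onesIn_eq_zero.1 hy k hk, onesIn_eq_zero.1 h0 k hk]
          · exact (h1 k hk).symm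
        simp [h0, this]
      · simp [h1]
    · simp
  · rw [if_neg h0]
    by_cases h1 : onesIn C x = 1
    · rw [if_pos h1, Finset.mul_sum, ← Finset.sum_image (f := fun y => (C.card : ℂ)⁻¹ * f y) hinj]
      symm
      refine Finset.sum_subset_zero_on_sdiff (Finset.subset_univ _) ?_ ?_
      · intro y hy
        by_cases h2 : ∀ k ∉ C, x k = y k
        · have : onesIn C y ≠ 1 := fun h3 => by
            obtain ⟨i, hi, h⟩ := onesIn_eq_one.1 h3
            simp only [Finset.mem_sdiff, Finset.mem_univ, true_and, Finset.mem_image] at hy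
            refine hy ⟨i, hi, funext fun k => ?_⟩
            by_cases hk : k ∈ C
            · simp [resetTo, hk, h k hk]
            · simp [resetTo, hk, h2 k hk]
          simp [h0, this]
        · simp [h2]
      · intro y hy
        obtain ⟨i, hi, rfl⟩ := Finset.mem_image.1 hy
        have h2 : ∀ k ∉ C, x k = resetTo C i x k := fun k hk => by simp [resetTo, hk]
        simp [h1, onesIn_resetTo_self hi, if_pos h2]
    · simp [h0, h1]

theorem resetTo_eq_pairIdx {m : ℕ} {C : Finset (Fin m)} {i : Fin m} {x : QIdx m} (hi : i ∈ C)
    (hx : onesIn Cᶜ x = 0) : resetTo C i x = pairIdx i i := funext fun k => by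
  have := onesIn_eq_zero.1 hx k
  by_cases hk : k ∈ C <;> simp_all [resetTo, pairIdx]
  rintro rfl
  exact hk hi

section Overlap

variable {m : ℕ} {A B : Finset (Fin m)}

theorem mem_of_union_eq_univ (hAB : A ∪ B = Finset.univ) (k : Fin m) : k ∈ A ∨ k ∈ B := by
  simpa using Finset.ext_iff.mp hAB k

theorem onesIn_of_left_eq_zero (hAB : A ∪ B = Finset.univ) {x : QIdx m} (hx : onesIn A x = 0) :
    onesIn B x = onesIn Aᶜ x := by
  unfold onesIn
  congr 1
  ext k
  have := onesIn_eq_zero.1 hx k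
  have := mem_of_union_eq_univ hAB k
  by_cases hk : k ∈ A <;> simp_all

theorem onesIn_compl_of_left_eq_zero (hAB : A ∪ B = Finset.univ) {x : QIdx m}
    (hx : onesIn A x = 0) : onesIn Bᶜ x = 0 := by
  rw [onesIn_eq_zero] at hx ⊢
  intro k hk
  have := mem_of_union_eq_univ hAB k
  exact hx k (by simp_all)

theorem onesIn_resetTo_of_notMem (hAB : A ∪ B = Finset.univ) {i : Fin m} (hi : i ∉ B)
    (x : QIdx m) : onesIn B (resetTo A i x) = onesIn Aᶜ x := by
  unfold onesIn
  congr 1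
  ext k
  have := mem_of_union_eq_univ hAB k
  rw [Finset.mem_filter, Finset.mem_filter, resetTo]
  by_cases hk : k ∈ A
  · by_cases hki : k = i <;> simp_all
  · simp_all

theorem onesIn_resetTo_of_mem (hAB : A ∪ B = Finset.univ) {i : Fin m} (hi : i ∈ B) (hiA : i ∈ A)
    (x : QIdx m) : onesIn B (resetTo A i x) = onesIn Aᶜ x + 1 := by
  have hn : i ∉ Aᶜ.filter fun k => x k = 1 := by simp [hiA]
  unfold onesIn
  rw [← Finset.card_insert_of_notMem hn]
  congr 1
  ext k
  have := mem_of_union_eq_univ hAB k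
  rw [Finset.mem_insert, Finset.mem_filter, Finset.mem_filter, resetTo]
  by_cases hk : k ∈ A
  · by_cases hki : k = i <;> simp_all
  · have : k ≠ i := fun h => hk (h ▸ hiA)
    simp_all

theorem resetTo_resetTo_of_notMem (hAB : A ∪ B = Finset.univ) {i j : Fin m} (hi : i ∉ B)
    (hj : j ∈ B) (x : QIdx m) : resetTo B j (resetTo A i x) = pairIdx i j := funext fun k => by
  have := mem_of_union_eq_univ hAB k
  by_cases hk : k ∈ B
  · have : k ≠ i := fun h => hi (h ▸ hk)
    simp_all [resetTo, pairIdx]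
  · have : k ≠ j := fun h => hk (h ▸ hj)
    simp_all [resetTo, pairIdx]

theorem resetTo_resetTo_of_mem (hAB : A ∪ B = Finset.univ) {i j : Fin m} (hi : i ∈ B)
    (hj : j ∈ B) (x : QIdx m) : resetTo B j (resetTo A i x) = pairIdx j j := funext fun k => by
  have := mem_of_union_eq_univ hAB k
  by_cases hk : k ∈ B
  · simp_all [resetTo, pairIdx]
  · have h1 : k ≠ j := fun h => hk (h ▸ hj)
    have h2 : k ≠ i := fun h => hk (h ▸ hi)
    simp_all [resetTo, pairIdx]

/-- The value of `(Π_{A∪B} - Π_A Π_B) f` at `x`, sorted by the number of ones in `A` and off `A`. -/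
theorem PiC_overlap_mulVec (hAB : A ∪ B = Finset.univ) (f : QIdx m → ℂ) (x : QIdx m) :
    ((PiC m (A ∪ B) - PiC m A * PiC m B) *ᵥ f) x =
      if onesIn A x = 0 ∧ onesIn Aᶜ x = 1 then
        (m : ℂ)⁻¹ * ∑ i, f (pairIdx i i) - (B.card : ℂ)⁻¹ * ∑ j ∈ B, f (pairIdx j j)
      else if onesIn A x = 1 ∧ onesIn Aᶜ x = 0 then
        (m : ℂ)⁻¹ * ∑ i, f (pairIdx i i) - (A.card : ℂ)⁻¹ * (∑ i ∈ Bᶜ, f (pairIdx i i) +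
          (A ∩ B).card * ((B.card : ℂ)⁻¹ * ∑ j ∈ B, f (pairIdx j j)))
      else if onesIn A x = 1 ∧ onesIn Aᶜ x = 1 then
        -((A.card : ℂ)⁻¹ * ((B.card : ℂ)⁻¹ * ∑ i ∈ Bᶜ, ∑ j ∈ B, f (pairIdx i j)))
      else 0 := by
  have hc : (Finset.univ : Finset (Fin m))ᶜ = ∅ := by simp
  have hr : ∀ i, resetTo Finset.univ i x = pairIdx i i := fun i =>
    resetTo_eq_pairIdx (Finset.mem_univ i) (by simp [onesIn_eq_zero])
  have hsplit : ∀ g : Fin m → ℂ, ∑ i ∈ A, g i = ∑ i ∈ Bᶜ, g i + ∑ i ∈ A ∩ B, g i := fun g => by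
    rw [← Finset.sum_union]
    · congr 1
      ext k
      have := mem_of_union_eq_univ hAB k
      by_cases hk : k ∈ B <;> simp_all
    · rw [Finset.disjoint_left]
      intro k
      simp +contextual
  rw [sub_mulVec, ← mulVec_mulVec, Pi.sub_apply, hAB, PiC_mulVec Finset.univ,
    PiC_mulVec A, onesIn_union_compl A x]
  simp only [hr, Finset.card_univ, Fintype.card_fin]
  by_cases hA0 : onesIn A x = 0
  · have hB := onesIn_of_left_eq_zero hAB hA0
    have hj : ∑ j ∈ B, f (resetTo B j x) = ∑ j ∈ B, f (pairIdx j j) :=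
      Finset.sum_congr rfl fun j hj => by
        rw [resetTo_eq_pairIdx hj (onesIn_compl_of_left_eq_zero hAB hA0)]
    rw [PiC_mulVec B, hB, hj]
    by_cases hZ0 : onesIn Aᶜ x = 0
    · simp [hA0, hZ0]
    · by_cases hZ1 : onesIn Aᶜ x = 1 <;> simp [hA0, hZ0, hZ1]
  · by_cases hA1 : onesIn A x = 1
    · rw [hsplit]
      have h1 : ∀ i ∈ A ∩ B, (PiC m B *ᵥ f) (resetTo A i x) =
          if onesIn Aᶜ x = 0 then (B.card : ℂ)⁻¹ * ∑ j ∈ B, f (pairIdx j j) else 0 := by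
        intro i hi
        obtain ⟨hiA, hiB⟩ := Finset.mem_inter.1 hi
        rw [PiC_mulVec B, onesIn_resetTo_of_mem hAB hiB hiA]
        rw [Finset.sum_congr rfl fun j hj => by rw [resetTo_resetTo_of_mem hAB hiB hj]]
        simp
      have h2 : ∀ i ∈ Bᶜ, (PiC m B *ᵥ f) (resetTo A i x) =
          if onesIn Aᶜ x = 0 then f (pairIdx i i) else if onesIn Aᶜ x = 1 then
            (B.card : ℂ)⁻¹ * ∑ j ∈ B, f (pairIdx i j) else 0 := by
        intro i hi
        have hiB : i ∉ B := by simpa using hi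
        have hiA : i ∈ A := (mem_of_union_eq_univ hAB i).resolve_right hiB
        rw [PiC_mulVec B, onesIn_resetTo_of_notMem hAB hiB]
        rw [Finset.sum_congr rfl fun j hj => by rw [resetTo_resetTo_of_notMem hAB hiB hj]]
        by_cases hZ0 : onesIn Aᶜ x = 0
        · simp [hZ0, resetTo_eq_pairIdx hiA hZ0]
        · simp [hZ0]
      rw [Finset.sum_congr rfl h1, Finset.sum_congr rfl h2]
      by_cases hZ0 : onesIn Aᶜ x = 0
      · simp [hA1, hZ0]
      · by_cases hZ1 : onesIn Aᶜ x = 1 <;> simp [hA1, hZ0, hZ1, Finset.mul_sum]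
    · have h2 : onesIn A x + onesIn Aᶜ x ≠ 1 := by omega
      simp [hA0, hA1, h2]

theorem card_onesIn_eq_one_le (C : Finset (Fin m)) :
    (Finset.univ.filter fun x : QIdx m => onesIn C x = 1 ∧ onesIn Cᶜ x = 0).card ≤ C.card := by
  refine (Finset.card_le_card (t := C.image fun i => pairIdx i i) fun x hx => ?_).trans
    Finset.card_image_le
  obtain ⟨h1, h0⟩ := (Finset.mem_filter.1 hx).2
  obtain ⟨i, hi, h⟩ := onesIn_eq_one.1 h1
  refine Finset.mem_image.2 ⟨i, hi, ?_⟩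
  rw [← resetTo_eq_pairIdx hi h0]
  ext k
  by_cases hk : k ∈ C <;> simp [resetTo, hk, h]

theorem card_onesIn_eq_one_one_le (C : Finset (Fin m)) :
    (Finset.univ.filter fun x : QIdx m => onesIn C x = 1 ∧ onesIn Cᶜ x = 1).card ≤
      C.card * Cᶜ.card := by
  rw [← Finset.card_product]
  refine (Finset.card_le_card (t := (C ×ˢ Cᶜ).image fun i => pairIdx i.1 i.2)
    fun x hx => ?_).trans Finset.card_image_le
  obtain ⟨h1, h2⟩ := (Finset.mem_filter.1 hx).2
  obtain ⟨i, hi, h⟩ := onesIn_eq_one.1 h1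
  obtain ⟨j, hj, h'⟩ := onesIn_eq_one.1 h2
  refine Finset.mem_image.2 ⟨(i, j), Finset.mem_product.2 ⟨hi, hj⟩, funext fun k => ?_⟩
  have hj' : j ∉ C := by simpa using hj
  by_cases hk : k ∈ C
  · have : k ≠ j := fun e => hj' (e ▸ hk)
    simp [pairIdx, h k hk, this]
  · have : k ≠ i := fun e => hk (e ▸ hi)
    simp [pairIdx, h' k (by simpa using hk), this]

theorem norm_sum_sq_le {ι : Type*} (s : Finset ι) (e : ι → QIdx m) (he : Set.InjOn e s)
    (f : QIdx m → ℂ) : ‖∑ i ∈ s, f (e i)‖ ^ 2 ≤ s.card * ∑ x, ‖f x‖ ^ 2 := by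
  calc ‖∑ i ∈ s, f (e i)‖ ^ 2 ≤ (∑ i ∈ s, ‖f (e i)‖) ^ 2 := by
        gcongr
        exact norm_sum_le _ _
    _ ≤ s.card * ∑ i ∈ s, ‖f (e i)‖ ^ 2 := sq_sum_le_card_mul_sum_sq
    _ = s.card * ∑ x ∈ s.image e, ‖f x‖ ^ 2 := by rw [Finset.sum_image he]
    _ ≤ s.card * ∑ x, ‖f x‖ ^ 2 := by
        gcongr
        exact Finset.subset_univ _

theorem pairIdx_self_injective : Function.Injective fun i : Fin m => pairIdx i i := by
  intro i j h
  have := congrFun h i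
  by_contra hij
  simp [pairIdx, hij] at this

theorem pairIdx_injOn (C : Finset (Fin m)) :
    Set.InjOn (fun i : Fin m × Fin m => pairIdx i.1 i.2) ((Cᶜ ×ˢ C : Finset _) : Set _) := by
  rintro ⟨i, j⟩ hij ⟨i', j'⟩ hij' h
  simp only [Finset.coe_product, Set.mem_prod, Finset.mem_coe, Finset.mem_compl] at hij hij'
  have h1 := congrFun h i
  have h2 := congrFun h j
  have n1 : i ≠ j' := fun e => hij.1 (e ▸ hij'.2)
  have n2 : j ≠ i' := fun e => hij'.1 (e ▸ hij.2)
  simp only [pairIdx, true_or, or_true, if_true] at h1 h2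
  have e1 : i = i' := by
    by_contra hne
    simp [hne, n1] at h1
  have e2 : j = j' := by
    by_contra hne
    simp [hne, n2] at h2
  rw [e1, e2]

/-- Bound on `‖(Π_{A∪B} - Π_A Π_B) f‖²`. -/
theorem sum_norm_sq_PiC_overlap_le (hAB : A ∪ B = Finset.univ) {a p : ℕ} (ha : 0 < a)
    (hA : A.card = a) (hB : B.card = a) (hm : m = a + p) (f : QIdx m → ℂ) :
    ∑ x, ‖((PiC m (A ∪ B) - PiC m A * PiC m B) *ᵥ f) x‖ ^ 2 ≤
      (5 * (p / a : ℝ)) ^ 2 * ∑ x, ‖f x‖ ^ 2 := by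
  have hAc : Aᶜ.card = p := by rw [Finset.card_compl, Fintype.card_fin]; omega
  have hBc : Bᶜ.card = p := by rw [Finset.card_compl, Fintype.card_fin]; omega
  have hI : (A ∩ B).card + p = a := by
    have := Finset.card_union_add_card_inter A B
    rw [hAB, Finset.card_univ, Fintype.card_fin] at this
    omega
  have hIc : ((A ∩ B).card : ℂ) = a - p := by rw [← hI]; push_cast; ring
  set N := ∑ x, ‖f x‖ ^ 2 with hN
  have hN0 : 0 ≤ N := by positivity
  set SX := ∑ i ∈ Bᶜ, f (pairIdx i i) with hSX
  set SB := ∑ i ∈ B, f (pairIdx i i) with hSB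
  set T := ∑ i ∈ Bᶜ, ∑ j ∈ B, f (pairIdx i j) with hT
  have hSXle : ‖SX‖ ^ 2 ≤ p * N :=
    hBc ▸ norm_sum_sq_le Bᶜ _ pairIdx_self_injective.injOn f
  have hSBle : ‖SB‖ ^ 2 ≤ a * N :=
    hB ▸ norm_sum_sq_le B _ pairIdx_self_injective.injOn f
  have hTle : ‖T‖ ^ 2 ≤ p * a * N := by
    have := norm_sum_sq_le (Bᶜ ×ˢ B) _ (pairIdx_injOn B) f
    rw [Finset.card_product, hBc, hB, Finset.sum_product] at this
    exact_mod_cast this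
  have hS : ∑ i, f (pairIdx i i) = SX + SB := by
    rw [add_comm, hSX, hSB, Finset.sum_add_sum_compl]
  have haC : (a : ℂ) ≠ 0 := by exact_mod_cast ha.ne'
  have haR : (0 : ℝ) < a := by exact_mod_cast ha
  have hapC : (a + p : ℂ) ≠ 0 := by exact_mod_cast (by omega : a + p ≠ 0)
  have hmC : (m : ℂ) = a + p := by rw [hm]; push_cast; rfl
  set β := (a : ℂ) * SX - p * SB with hβ
  have hβle : ‖β‖ ^ 2 ≤ 2 * (a ^ 2 * (p * N) + p ^ 2 * (a * N)) := by
    have h1 : ‖β‖ ≤ a * ‖SX‖ + p * ‖SB‖ := by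
      simpa [hβ] using norm_sub_le ((a : ℂ) * SX) (p * SB)
    calc ‖β‖ ^ 2 ≤ (a * ‖SX‖ + p * ‖SB‖) ^ 2 := by gcongr
      _ ≤ 2 * ((a * ‖SX‖) ^ 2 + (p * ‖SB‖) ^ 2) := add_sq_le
      _ ≤ _ := by
        rw [mul_pow, mul_pow]
        gcongr
  have e1 : (m : ℂ)⁻¹ * (SX + SB) - (a : ℂ)⁻¹ * SB = (a * (a + p) : ℂ)⁻¹ * β := by
    rw [hmC, hβ]; field_simp; ring
  have e2 : (m : ℂ)⁻¹ * (SX + SB) - (a : ℂ)⁻¹ * (SX + (a - p) * ((a : ℂ)⁻¹ * SB)) =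
      -(p * (a ^ 2 * (a + p) : ℂ)⁻¹ * β) := by
    rw [hmC, hβ]; field_simp; ring
  have hpt : ∀ x, ‖((PiC m (A ∪ B) - PiC m A * PiC m B) *ᵥ f) x‖ ^ 2 =
      (if onesIn Aᶜ x = 1 ∧ onesIn Aᶜᶜ x = 0 then ‖(a * (a + p) : ℂ)⁻¹ * β‖ ^ 2 else 0) +
      (if onesIn A x = 1 ∧ onesIn Aᶜ x = 0 then ‖p * (a ^ 2 * (a + p) : ℂ)⁻¹ * β‖ ^ 2 else 0) +
      (if onesIn A x = 1 ∧ onesIn Aᶜ x = 1 then ‖(a : ℂ)⁻¹ * ((a : ℂ)⁻¹ * T)‖ ^ 2 else 0) := by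
    intro x
    rw [PiC_overlap_mulVec hAB, hA, hB, hIc, hS, e1, e2, compl_compl]
    by_cases hA0 : onesIn A x = 0
    · by_cases hZ : onesIn Aᶜ x = 1 <;> simp [hA0, hZ]
    · by_cases hA1 : onesIn A x = 1
      · by_cases hZ0 : onesIn Aᶜ x = 0
        · simp [hA1, hZ0]
        · by_cases hZ : onesIn Aᶜ x = 1 <;> simp [hA1, hZ0, hZ, hT]
      · simp [hA0, hA1]
  simp only [hpt, Finset.sum_add_distrib, ← Finset.sum_filter, Finset.sum_const, nsmul_eq_mul]
  have c1 := card_onesIn_eq_one_le Aᶜ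
  have c2 := card_onesIn_eq_one_le A
  have c3 := card_onesIn_eq_one_one_le A
  rw [hAc] at c1 c3
  rw [hA] at c2 c3
  have n1 : ‖(a * (a + p) : ℂ)⁻¹ * β‖ ^ 2 = (a * (a + p) : ℝ)⁻¹ ^ 2 * ‖β‖ ^ 2 := by
    have : (a * (a + p) : ℂ) = ((a * (a + p) : ℝ) : ℂ) := by push_cast; rfl
    rw [this, norm_mul, norm_inv, Complex.norm_real, Real.norm_of_nonneg (by positivity), mul_pow]
  have n2 : ‖p * (a ^ 2 * (a + p) : ℂ)⁻¹ * β‖ ^ 2 =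
      (p * (a ^ 2 * (a + p) : ℝ)⁻¹) ^ 2 * ‖β‖ ^ 2 := by
    have : (a ^ 2 * (a + p) : ℂ) = ((a ^ 2 * (a + p) : ℝ) : ℂ) := by push_cast; rfl
    rw [this, norm_mul, norm_mul, norm_inv, Complex.norm_real,
      Real.norm_of_nonneg (by positivity), mul_pow, Complex.norm_natCast]
  have n3 : ‖(a : ℂ)⁻¹ * ((a : ℂ)⁻¹ * T)‖ ^ 2 = (a : ℝ)⁻¹ ^ 4 * ‖T‖ ^ 2 := by
    simp only [norm_mul, norm_inv, Complex.norm_natCast]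
    ring
  rw [n1, n2, n3]
  set D := 2 * ((a : ℝ) ^ 2 * (p * N) + p ^ 2 * (a * N)) with hD
  calc _ ≤ (p : ℝ) * ((a * (a + p) : ℝ)⁻¹ ^ 2 * D) +
        (a : ℝ) * ((p * (a ^ 2 * (a + p) : ℝ)⁻¹) ^ 2 * D) +
        ((a * p : ℕ) : ℝ) * ((a : ℝ)⁻¹ ^ 4 * (p * a * N)) := by gcongr
    _ = 3 * (p / a : ℝ) ^ 2 * N := by
        rw [hD]; push_cast; field_simp; ring
    _ ≤ (5 * (p / a : ℝ)) ^ 2 * N := by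
        rw [mul_pow]
        gcongr
        norm_num

end Overlap

theorem opNorm_le_of_sum_norm_sq_le {I J : Type*} [Fintype I] [Fintype J] [DecidableEq J]
    (M : Matrix I J ℂ) {c : ℝ} (hc : 0 ≤ c)
    (h : ∀ f : J → ℂ, ∑ i, ‖(M *ᵥ f) i‖ ^ 2 ≤ c ^ 2 * ∑ j, ‖f j‖ ^ 2) : opNorm M ≤ c := by
  refine ContinuousLinearMap.opNorm_le_bound _ hc fun f => ?_
  refine le_of_sq_le_sq ?_ (by positivity)
  rw [mul_pow, EuclideanSpace.norm_sq_eq, EuclideanSpace.norm_sq_eq]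
  exact h f.ofLp

/-- Let `m ≥ 2`, `γ ∈ (0,1)` with `l = γm` and `a = (1+γ)m/2` positive
integers, and let `A = {1,…,a}` and `B = {m-a+1,…,m}` (so `|A| = |B| = a`, `|A∩B| = l` and
`A∪B = Λ`).  Then `‖Π_{A∪B} - Π_A·Π_B‖ ≤ 5(1-γ)/(1+γ)`. -/
theorem PiC_overlap_bound (m : ℕ) (hm : 2 ≤ m) (γ : ℝ) (hγ : γ ∈ Set.Ioo (0 : ℝ) 1)
    (l a : ℕ) (hl0 : 0 < l) (ha0 : 0 < a)
    (hl : (l : ℝ) = γ * m) (ha : (a : ℝ) = (1 + γ) * m / 2)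
    (A B : Finset (Fin m))
    (hA : A = Finset.univ.filter fun k : Fin m => k.1 < a)
    (hB : B = Finset.univ.filter fun k : Fin m => m - a ≤ k.1) :
    opNorm (PiC m (A ∪ B) - PiC m A * PiC m B) ≤ 5 * (1 - γ) / (1 + γ) := by
  obtain ⟨h0, h1⟩ := hγ
  have hmR : (0 : ℝ) < m := by exact_mod_cast (by omega : 0 < m)
  have h2a : 2 * a = m + l := by
    have : (2 * a : ℝ) = m + l := by rw [ha, hl]; ring
    exact_mod_cast this
  have hlm : l < m := by
    have : (l : ℝ) < m := by rw [hl]; nlinarith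
    exact_mod_cast this
  obtain ⟨p, hp⟩ : ∃ p, m = a + p := ⟨m - a, by omega⟩
  have hpR : (p : ℝ) = (1 - γ) * m / 2 := by
    have : (m : ℝ) = a + p := by exact_mod_cast hp
    linarith
  have hAB : A ∪ B = Finset.univ := by
    ext k
    simp only [hA, hB, Finset.mem_union, Finset.mem_filter, Finset.mem_univ, true_and, iff_true]
    omega
  have hAcard : A.card = a := by
    rw [hA, Fin.card_filter_val_lt]
    omega
  have hBcard : B.card = a := by
    have h : B = (Finset.univ.filter fun k : Fin m => k.1 < m - a)ᶜ := by
      ext k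
      simp [hB]
    rw [h, Finset.card_compl, Fin.card_filter_val_lt, Fintype.card_fin]
    omega
  have hval : 5 * (1 - γ) / (1 + γ) = 5 * (p / a : ℝ) := by
    rw [hpR, ha]
    field_simp
  rw [hval]
  exact opNorm_le_of_sum_norm_sq_le _ (by positivity)
    (sum_norm_sq_PiC_overlap_le hAB ha0 hAcard hBcard hp)

end QSim
end
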